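/- Let n2 be the 7-dimensional nilpotent real Lie algebra with basis e1,…,e7 and only nonzero bracket [e1,e2] = −e6 (up to antisymmetry), and let ψ = −e^{1234}+e^{1257}+e^{1356}−e^{1467}+e^{2367}+e^{2456}−e^{3457}. Then the stabilizer of ψ in the derivation Lie algebra of n2 is not abelian: there exist derivations D₁, D₂ of n2, both stabilizing ψ, whose commutator D₁∘D₂ − D₂∘D₁ is nonzero. (This is the key computation showing that the automorphism group of a coclosed G2-structure need not be abelian, in contrast to the closed case.) -/

import Mathlib

noncomputable section

/-- The underlying 7-dimensional real vector space. -/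
abbrev V : Type := Fin 7 → ℝ

/-- The Lie bracket of the nilpotent Lie algebra `n₂` ([e1,e2] = -e6), extended bilinearly from the structure constants. -/
def bk (x y : V) : V :=
  ![0, 0, 0, 0, 0, -(x 0 * y 1 - x 1 * y 0), 0]

/-- The alternating 4-form `e^i ∧ e^j ∧ e^k ∧ e^l` on `V`. -/
def w4 (i j k l : Fin 7) : AlternatingMap ℝ V ℝ (Fin 4) :=
  (Matrix.detRowAlternating : AlternatingMap ℝ (Fin 4 → ℝ) ℝ (Fin 4)).compLinearMap
    (LinearMap.pi (fun a => LinearMap.proj (![i, j, k, l] a)))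

/-- A linear map `D : V → V` is a derivation of the Lie algebra `(V, bk)`. -/
def IsDeriv (D : V →ₗ[ℝ] V) : Prop :=
  ∀ x y : V, D (bk x y) = bk (D x) y + bk x (D y)

/-- `D` stabilizes (annihilates infinitesimally) the 4-form `ψ`. -/
def Stab4 (ψ : AlternatingMap ℝ V ℝ (Fin 4)) (D : V →ₗ[ℝ] V) : Prop :=
  ∀ x y z w : V, ψ ![D x, y, z, w] + ψ ![x, D y, z, w] + ψ ![x, y, D z, w] + ψ ![x, y, z, D w] = 0

/-- The distinguished 4-form. -/
def psi : AlternatingMap ℝ V ℝ (Fin 4) :=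
  -w4 0 1 2 3 + w4 0 1 4 6 + w4 0 2 4 5 - w4 0 3 5 6 + w4 1 2 5 6 + w4 1 3 4 5
    - w4 2 3 4 6

/-- The infinitesimal rotation `e₃ ↦ e₇`, `e₄ ↦ e₅`, `e₅ ↦ -e₄`, `e₇ ↦ -e₃`. -/
def rotationA : V →ₗ[ℝ] V where
  toFun x := ![0, 0, -x 6, -x 4, x 3, 0, x 2]
  map_add' x y := by
    ext i
    fin_cases i <;> simp <;> ring
  map_smul' c x := by
    ext i
    fin_cases i <;> simp

/-- The infinitesimal rotation `e₃ ↦ -e₅`, `e₄ ↦ e₇`, `e₅ ↦ e₃`, `e₇ ↦ -e₄`. -/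
def rotationB : V →ₗ[ℝ] V where
  toFun x := ![0, 0, x 4, -x 6, -x 2, 0, x 3]
  map_add' x y := by
    ext i
    fin_cases i <;> simp <;> ring
  map_smul' c x := by
    ext i
    fin_cases i <;> simp

lemma rotationA_apply (x : V) : rotationA x = ![0, 0, -x 6, -x 4, x 3, 0, x 2] := rfl

lemma rotationB_apply (x : V) : rotationB x = ![0, 0, x 4, -x 6, -x 2, 0, x 3] := rfl

lemma isDeriv_rotationA : IsDeriv rotationA := by
  intro x y
  ext i
  fin_cases i <;> simp [rotationA_apply, bk]

lemma isDeriv_rotationB : IsDeriv rotationB := by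
  intro x y
  ext i
  fin_cases i <;> simp [rotationB_apply, bk]

/-- Laplace expansion of `w4` along its first two arguments. -/
lemma w4_apply (i j k l : Fin 7) (x y z w : V) :
    w4 i j k l ![x, y, z, w] =
      (x i * y j - x j * y i) * (z k * w l - z l * w k)
      - (x i * y k - x k * y i) * (z j * w l - z l * w j)
      + (x i * y l - x l * y i) * (z j * w k - z k * w j)
      + (x j * y k - x k * y j) * (z i * w l - z l * w i)
      - (x j * y l - x l * y j) * (z i * w k - z k * w i)
      + (x k * y l - x l * y k) * (z i * w j - z j * w i) := by
  have h : w4 i j k l ![x, y, z, w] = Matrix.det !![x i, x j, x k, x l; y i, y j, y k, y l;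
      z i, z j, z k, z l; w i, w j, w k, w l] := by
    refine congrArg (Matrix.det (R := ℝ) (n := Fin 4)) ?_
    ext a b
    fin_cases a <;> fin_cases b <;> rfl
  rw [h]
  simp [Matrix.det_succ_row_zero, Fin.sum_univ_succ, Fin.succAbove]
  ring

lemma psi_apply (x y z w : V) :
    psi ![x, y, z, w] =
      -w4 0 1 2 3 ![x, y, z, w] + w4 0 1 4 6 ![x, y, z, w] + w4 0 2 4 5 ![x, y, z, w]
        - w4 0 3 5 6 ![x, y, z, w] + w4 1 2 5 6 ![x, y, z, w] + w4 1 3 4 5 ![x, y, z, w]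
        - w4 2 3 4 6 ![x, y, z, w] := rfl

lemma stab4_psi_rotationA : Stab4 psi rotationA := by
  intro x y z w
  simp only [psi_apply, w4_apply, rotationA_apply, Matrix.cons_val]
  ring

lemma stab4_psi_rotationB : Stab4 psi rotationB := by
  intro x y z w
  simp only [psi_apply, w4_apply, rotationB_apply, Matrix.cons_val]
  ring

theorem statement_10 :
    ∃ D₁ D₂ : V →ₗ[ℝ] V, IsDeriv D₁ ∧ IsDeriv D₂ ∧ Stab4 psi D₁ ∧ Stab4 psi D₂ ∧
      D₁ ∘ₗ D₂ - D₂ ∘ₗ D₁ ≠ 0 := by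
  refine ⟨rotationA, rotationB, isDeriv_rotationA, isDeriv_rotationB, stab4_psi_rotationA,
    stab4_psi_rotationB, fun h => ?_⟩
  have h₁ := congrFun (LinearMap.congr_fun h (Pi.single 2 1)) 3
  simp [rotationA_apply, rotationB_apply] at h₁
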